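/- arXiv:1301.6799 — 9 statements merged into one kernel-verified Lean document; each statement's English description precedes it below -/
import Mathlib

section
/- LPO(μ,φ,𝒪) = 1 if and only if φ = R (every run satisfies φ); and LPSO(μ,φ,𝒪) = 1 if and only if the conditional entropy H(1_φ | 𝒪) equals 0. (Proposition 1, item 3.) -/
open scoped ENNReal Classical

/-- The probability of a set of runs under a PMF. -/
noncomputable def mOf {R : Type*} (μ : PMF R) (S : Set R) : ℝ≥0∞ :=
  ∑' ρ : S, μ ρ

/-- Liberal probabilistic opacity. -/
noncomputable def LPO {R Obs : Type*} (μ : PMF R) (φ : Set R) (O : R → Obs) : ℝ≥0∞ :=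
  ∑' o : Obs, if O ⁻¹' {o} ⊆ φ then mOf μ (O ⁻¹' {o}) else 0

/-- Liberal probabilistic symmetrical opacity. -/
noncomputable def LPSO {R Obs : Type*} (μ : PMF R) (φ : Set R) (O : R → Obs) : ℝ≥0∞ :=
  LPO μ φ O + LPO μ φᶜ O

/-- Restrictive probabilistic opacity. -/
noncomputable def RPO {R Obs : Type*} (μ : PMF R) (φ : Set R) (O : R → Obs) : ℝ≥0∞ :=
  (∑' o : Obs, (mOf μ (O ⁻¹' {o})) ^ 2 / mOf μ (φᶜ ∩ O ⁻¹' {o}))⁻¹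

/-- Vulnerability of φ within the observation class of o. -/
noncomputable def Vul {R Obs : Type*} (μ : PMF R) (φ : Set R) (O : R → Obs) (o : Obs) : ℝ≥0∞ :=
  max (mOf μ (φ ∩ O ⁻¹' {o})) (mOf μ (φᶜ ∩ O ⁻¹' {o})) / mOf μ (O ⁻¹' {o})

/-- Restrictive probabilistic symmetric opacity. -/
noncomputable def RPSO {R Obs : Type*} (μ : PMF R) (φ : Set R) (O : R → Obs) : ℝ≥0∞ :=
  (∑' o : Obs, mOf μ (O ⁻¹' {o}) *
    (if Vul μ φ O o = 1 then ⊤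
     else ENNReal.ofReal (- Real.logb 2 ((1 - Vul μ φ O o).toReal))))⁻¹

/-- φ is opaque for the observation O. -/
def IsOpaque {R Obs : Type*} (φ : Set R) (O : R → Obs) : Prop :=
  ∀ o : Obs, ¬ O ⁻¹' {o} ⊆ φ

/-- φ is symmetrically opaque for the observation O. -/
def IsSymOpaque {R Obs : Type*} (φ : Set R) (O : R → Obs) : Prop :=
  ∀ o : Obs, ¬ O ⁻¹' {o} ⊆ φ ∧ ¬ O ⁻¹' {o} ⊆ φᶜ

/-- The binary entropy function, with the convention 0 · log₂ 0 = 0. -/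
noncomputable def binEntropy (x : ℝ) : ℝ :=
  -(x * Real.logb 2 x + (1 - x) * Real.logb 2 (1 - x))

/-- The conditional entropy H(1_φ | 𝒪). -/
noncomputable def condEntropy {R Obs : Type*} (μ : PMF R) (φ : Set R) (O : R → Obs) : ℝ :=
  ∑' o : Obs, (mOf μ (O ⁻¹' {o})).toReal *
    binEntropy ((mOf μ (φ ∩ O ⁻¹' {o}) / mOf μ (O ⁻¹' {o})).toReal)

lemma mOf_eq_zero_iff {R : Type*} {μ : PMF R} (hsupp : ∀ ρ : R, μ ρ ≠ 0) {S : Set R} :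
    mOf μ S = 0 ↔ S = ∅ := by
  simp [mOf, ENNReal.tsum_eq_zero, hsupp, Set.eq_empty_iff_forall_notMem]

lemma mOf_le_one {R : Type*} (μ : PMF R) (S : Set R) : mOf μ S ≤ 1 :=
  μ.tsum_coe ▸ ENNReal.tsum_comp_le_tsum_of_injective Subtype.val_injective μ

lemma mOf_ne_top {R : Type*} (μ : PMF R) (S : Set R) : mOf μ S ≠ ⊤ :=
  ((mOf_le_one μ S).trans_lt ENNReal.one_lt_top).ne

lemma mOf_inter_add_compl_inter {R : Type*} (μ : PMF R) (φ S : Set R) :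
    mOf μ (φ ∩ S) + mOf μ (φᶜ ∩ S) = mOf μ S := by
  simp only [mOf]
  rw [tsum_subtype (φ ∩ S) μ, tsum_subtype (φᶜ ∩ S) μ, tsum_subtype S μ, ← ENNReal.tsum_add]
  refine tsum_congr fun ρ => ?_
  by_cases h : ρ ∈ φ <;> by_cases h' : ρ ∈ S <;> simp [h, h']

lemma tsum_mOf_preimage {R Obs : Type*} (μ : PMF R) (O : R → Obs) :
    ∑' o : Obs, mOf μ (O ⁻¹' {o}) = 1 :=
  (ENNReal.tsum_fiberwise μ O).trans μ.tsum_coe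

lemma tsum_ite_eq_one_iff {ι : Type*} {f : ι → ℝ≥0∞} (hf : ∑' i, f i = 1)
    (hpos : ∀ i, f i ≠ 0) (p : ι → Prop) [DecidablePred p] :
    ∑' i, (if p i then f i else 0) = 1 ↔ ∀ i, p i := by
  refine ⟨fun h => ?_, fun h => by simpa [h] using hf⟩
  have hsplit : ∑' i, (if p i then f i else 0) + ∑' i, (if p i then 0 else f i) = 1 := by
    rw [← ENNReal.tsum_add, ← hf]
    refine tsum_congr fun i => ?_
    split_ifs <;> simp
  rw [h] at hsplit
  have hzero : ∑' i, (if p i then 0 else f i) = 0 :=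
    (ENNReal.add_right_inj ENNReal.one_ne_top).1 (hsplit.trans (add_zero 1).symm)
  intro i
  by_contra hi
  have := ENNReal.tsum_eq_zero.1 hzero i
  simp [hi, hpos i] at this

lemma binEntropy_eq_div_log_two (x : ℝ) : binEntropy x = Real.binEntropy x / Real.log 2 := by
  simp only [binEntropy, Real.binEntropy, Real.logb, Real.log_inv]
  ring

lemma binEntropy_nonneg {x : ℝ} (h₀ : 0 ≤ x) (h₁ : x ≤ 1) : 0 ≤ binEntropy x := by
  rw [binEntropy_eq_div_log_two]
  exact div_nonneg (Real.binEntropy_nonneg h₀ h₁) (Real.log_nonneg one_le_two)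

lemma binEntropy_le_one (x : ℝ) : binEntropy x ≤ 1 := by
  rw [binEntropy_eq_div_log_two]
  exact div_le_one_of_le₀ Real.binEntropy_le_log_two (Real.log_nonneg one_le_two)

lemma binEntropy_eq_zero_iff (x : ℝ) : binEntropy x = 0 ↔ x = 0 ∨ x = 1 := by
  rw [binEntropy_eq_div_log_two, div_eq_zero_iff,
    or_iff_left (Real.log_pos one_lt_two).ne', Real.binEntropy_eq_zero]

lemma mOf_div_le_one {R : Type*} (μ : PMF R) (φ S : Set R) :
    mOf μ (φ ∩ S) / mOf μ S ≤ 1 :=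
  ENNReal.div_le_of_le_mul (by simp [← mOf_inter_add_compl_inter μ φ S])

lemma toReal_mOf_div_le_one {R : Type*} (μ : PMF R) (φ S : Set R) :
    (mOf μ (φ ∩ S) / mOf μ S).toReal ≤ 1 :=
  ENNReal.toReal_le_of_le_ofReal zero_le_one (by simpa using mOf_div_le_one μ φ S)

lemma binEntropy_mOf_div_eq_zero_iff {R : Type*} {μ : PMF R} (hsupp : ∀ ρ : R, μ ρ ≠ 0)
    (φ : Set R) {S : Set R} (hS : S.Nonempty) :
    binEntropy ((mOf μ (φ ∩ S) / mOf μ S).toReal) = 0 ↔ S ⊆ φ ∨ S ⊆ φᶜ := by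
  have hm : mOf μ S ≠ 0 := fun h => hS.ne_empty ((mOf_eq_zero_iff hsupp).1 h)
  have h_zero : (mOf μ (φ ∩ S) / mOf μ S).toReal = 0 ↔ S ⊆ φᶜ := by
    rw [ENNReal.toReal_eq_zero_iff, or_iff_left
      ((mOf_div_le_one μ φ S).trans_lt ENNReal.one_lt_top).ne, ENNReal.div_eq_zero_iff,
      or_iff_left (mOf_ne_top μ S), mOf_eq_zero_iff hsupp, Set.subset_compl_iff_disjoint_left,
      Set.disjoint_iff_inter_eq_empty]
  have h_one : (mOf μ (φ ∩ S) / mOf μ S).toReal = 1 ↔ S ⊆ φ := by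
    rw [ENNReal.toReal_eq_one_iff, ENNReal.div_eq_one_iff hm (mOf_ne_top μ S),
      ← mOf_inter_add_compl_inter μ φ S, ← add_zero (mOf μ (φ ∩ S)), add_assoc, zero_add,
      ENNReal.add_right_inj (mOf_ne_top μ _), eq_comm, mOf_eq_zero_iff hsupp,
      ← Set.disjoint_iff_inter_eq_empty, Set.disjoint_compl_left_iff_subset]
  rw [binEntropy_eq_zero_iff, h_zero, h_one, or_comm]

lemma condEntropy_eq_zero_iff {R Obs : Type*} {μ : PMF R} (hsupp : ∀ ρ : R, μ ρ ≠ 0)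
    (φ : Set R) {O : R → Obs} (hsurj : Function.Surjective O) :
    condEntropy μ φ O = 0 ↔ ∀ o : Obs, O ⁻¹' {o} ⊆ φ ∨ O ⁻¹' {o} ⊆ φᶜ := by
  have hne (o : Obs) : (O ⁻¹' {o}).Nonempty := hsurj o
  have hnonneg (o : Obs) : 0 ≤ (mOf μ (O ⁻¹' {o})).toReal *
      binEntropy ((mOf μ (φ ∩ O ⁻¹' {o}) / mOf μ (O ⁻¹' {o})).toReal) :=
    mul_nonneg ENNReal.toReal_nonneg
      (binEntropy_nonneg ENNReal.toReal_nonneg (toReal_mOf_div_le_one μ φ _))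
  have hsum : Summable fun o : Obs => (mOf μ (O ⁻¹' {o})).toReal :=
    ENNReal.summable_toReal (by simp [tsum_mOf_preimage])
  have hsummable := Summable.of_nonneg_of_le hnonneg
    (fun o => mul_le_of_le_one_right ENNReal.toReal_nonneg (binEntropy_le_one _)) hsum
  rw [condEntropy, ← hsummable.hasSum_iff, hasSum_zero_iff_of_nonneg hnonneg, funext_iff]
  refine forall_congr' fun o => ?_
  rw [← binEntropy_mOf_div_eq_zero_iff hsupp φ (hne o), Pi.zero_apply, mul_eq_zero, or_iff_right]
  rw [ENNReal.toReal_eq_zero_iff, or_iff_left (mOf_ne_top μ _), mOf_eq_zero_iff hsupp]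
  exact (hne o).ne_empty

lemma LPSO_eq_tsum {R Obs : Type*} (μ : PMF R) (φ : Set R) {O : R → Obs}
    (hsurj : Function.Surjective O) :
    LPSO μ φ O = ∑' o : Obs,
      if O ⁻¹' {o} ⊆ φ ∨ O ⁻¹' {o} ⊆ φᶜ then mOf μ (O ⁻¹' {o}) else 0 := by
  rw [LPSO, LPO, LPO, ← ENNReal.tsum_add]
  refine tsum_congr fun o => ?_
  obtain ⟨ρ, hρ⟩ := hsurj o
  have hdisj : ¬ (O ⁻¹' {o} ⊆ φ ∧ O ⁻¹' {o} ⊆ φᶜ) := fun h => h.2 hρ (h.1 hρ)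
  by_cases h₁ : O ⁻¹' {o} ⊆ φ
  · have h₂ : ¬ O ⁻¹' {o} ⊆ φᶜ := fun h => hdisj ⟨h₁, h⟩
    rw [if_pos h₁, if_neg h₂, if_pos (Or.inl h₁), add_zero]
  · rw [if_neg h₁, zero_add]
    simp only [h₁, false_or]

/-- Proposition 1, item 3: LPO equals one iff φ always holds; LPSO equals one
iff the conditional entropy of 1_φ given 𝒪 vanishes. -/
theorem lpo_eq_one_iff {R Obs : Type*} [Countable R]
    (μ : PMF R) (φ : Set R) (O : R → Obs)
    (hsupp : ∀ ρ : R, μ ρ ≠ 0) (hsurj : Function.Surjective O) :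
    (LPO μ φ O = 1 ↔ φ = Set.univ) ∧ (LPSO μ φ O = 1 ↔ condEntropy μ φ O = 0) := by
  have hpos (o : Obs) : mOf μ (O ⁻¹' {o}) ≠ 0 := fun h =>
    Set.Nonempty.ne_empty (hsurj o) ((mOf_eq_zero_iff hsupp).1 h)
  have htsum := tsum_mOf_preimage μ O
  constructor
  · rw [LPO, tsum_ite_eq_one_iff htsum hpos, Set.eq_univ_iff_forall]
    exact ⟨fun h ρ => h (O ρ) rfl, fun h o ρ _ => h ρ⟩
  · rw [LPSO_eq_tsum μ φ hsurj, condEntropy_eq_zero_iff hsupp φ hsurj,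
      tsum_ite_eq_one_iff htsum hpos]
end

section
/- Assume every state can reach a final state. Then for every q : Q the series ∑_{n : ℕ} ((A ^ n).mulVec β) q converges, and the vector L : Q → ℝ defined by L q = ∑'_{n : ℕ} ((A ^ n).mulVec β) q — the probability of the set of complete runs of the substochastic automaton starting at q — is the unique solution of the linear system associated with the automaton, i.e. the unique X : Q → ℝ satisfying X q = (∑_{q'} A q q' · X q') + β q for every q : Q. (Lemma 1 of the paper.) -/
/-- A state `q` can reach a final state: there is a path of positive-probability
transitions from `q` to some state with positive termination probability. -/
def CanReachFinal {Q : Type*} (A : Matrix Q Q ℝ) (β : Q → ℝ) (q : Q) : Prop :=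
  ∃ (m : ℕ) (f : ℕ → Q), f 0 = q ∧ (∀ i < m, 0 < A (f i) (f (i + 1))) ∧ 0 < β (f m)

/-- Maximum principle: a fixed vector of a nonnegative substochastic matrix vanishes if every
state can reach a final state. -/
theorem eq_zero_of_forall_eq_sum_mul
    {Q : Type*} [Fintype Q] [Nonempty Q] {A : Matrix Q Q ℝ} {β : Q → ℝ}
    (hA : ∀ q q' : Q, 0 ≤ A q q') (hβ : ∀ q : Q, 0 ≤ β q)
    (hsub : ∀ q : Q, (∑ q' : Q, A q q') + β q ≤ 1)
    (hreach : ∀ q : Q, CanReachFinal A β q)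
    {D : Q → ℝ} (hD : ∀ q : Q, D q = ∑ q' : Q, A q q' * D q') (q : Q) : D q = 0 := by
  obtain ⟨p, hp⟩ := Finite.exists_max fun r => |D r|
  have key (r : Q) (hr : |D r| = |D p|) :
      β r * |D p| + ∑ q', A r q' * (|D p| - |D q'|) ≤ 0 := by
    have h1 : |D r| ≤ ∑ q', A r q' * |D q'| := by
      rw [hD r]
      refine (Finset.abs_sum_le_sum_abs _ _).trans_eq (Finset.sum_congr rfl fun q' _ => ?_)
      rw [abs_mul, abs_of_nonneg (hA r q')]
    have h2 := mul_le_mul_of_nonneg_right (hsub r) (abs_nonneg (D p))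
    simp only [mul_sub, Finset.sum_sub_distrib, ← Finset.sum_mul]
    linarith
  have gap_nonneg (r q' : Q) : 0 ≤ A r q' * (|D p| - |D q'|) :=
    mul_nonneg (hA r q') (sub_nonneg.2 (hp q'))
  obtain ⟨m, f, hf0, hf, hfm⟩ := hreach p
  have hpath : ∀ i ≤ m, |D (f i)| = |D p| := by
    intro i
    induction i with
    | zero => intro _; rw [hf0]
    | succ i ih =>
      intro hi
      have h1 := key (f i) (ih (by omega))
      have h2 := Finset.single_le_sum (fun q' _ => gap_nonneg (f i) q')
        (Finset.mem_univ (f (i + 1)))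
      have h3 := mul_nonneg (hβ (f i)) (abs_nonneg (D p))
      have h4 : |D p| - |D (f (i + 1))| ≤ 0 :=
        nonpos_of_mul_nonpos_right (by linarith) (hf i hi)
      exact le_antisymm (hp _) (by linarith)
  have h1 := key (f m) (hpath m le_rfl)
  have h2 := Finset.sum_nonneg fun q' (_ : q' ∈ Finset.univ) => gap_nonneg (f m) q'
  have h3 : |D p| ≤ 0 := nonpos_of_mul_nonpos_right (by linarith) hfm
  exact abs_nonpos_iff.1 ((hp q).trans h3)

theorem pow_succ_mulVec_apply {Q : Type*} [Fintype Q] [DecidableEq Q]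
    (A : Matrix Q Q ℝ) (β : Q → ℝ) (n : ℕ) (q : Q) :
    ((A ^ (n + 1)).mulVec β) q = ∑ q', A q q' * ((A ^ n).mulVec β) q' := by
  rw [pow_succ', ← Matrix.mulVec_mulVec]
  rfl

theorem pow_mulVec_nonneg {Q : Type*} [Fintype Q] [DecidableEq Q]
    {A : Matrix Q Q ℝ} {β : Q → ℝ} (hA : ∀ q q' : Q, 0 ≤ A q q') (hβ : ∀ q : Q, 0 ≤ β q)
    (n : ℕ) (q : Q) : 0 ≤ ((A ^ n).mulVec β) q := by
  induction n generalizing q with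
  | zero => simpa using hβ q
  | succ n ih =>
    rw [pow_succ_mulVec_apply]
    exact Finset.sum_nonneg fun q' _ => mul_nonneg (hA q q') (ih q')

theorem sum_range_pow_mulVec_le_one {Q : Type*} [Fintype Q] [DecidableEq Q]
    {A : Matrix Q Q ℝ} {β : Q → ℝ} (hA : ∀ q q' : Q, 0 ≤ A q q')
    (hsub : ∀ q : Q, (∑ q' : Q, A q q') + β q ≤ 1) (n : ℕ) (q : Q) :
    ∑ k ∈ Finset.range n, ((A ^ k).mulVec β) q ≤ 1 := by
  induction n generalizing q with
  | zero => simp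
  | succ n ih =>
    rw [Finset.sum_range_succ']
    simp only [pow_succ_mulVec_apply, pow_zero, Matrix.one_mulVec]
    rw [Finset.sum_comm]
    simp only [← Finset.mul_sum]
    refine le_trans ?_ (hsub q)
    gcongr with q' _
    exact mul_le_of_le_one_right (hA q q') (ih q')

/-- Lemma 1: for a substochastic automaton in which every state can reach a final
state, the vector of probabilities `L q = ∑' n, ((A ^ n).mulVec β) q` of the sets of
complete runs is well defined (the series converge) and is the unique solution of the
associated linear system `X q = (∑ q', A q q' * X q') + β q`. -/
theorem substochastic_linear_system_unique_solution
    {Q : Type*} [Fintype Q] [DecidableEq Q] [Nonempty Q]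
    (A : Matrix Q Q ℝ) (β : Q → ℝ)
    (hA : ∀ q q' : Q, 0 ≤ A q q') (hβ : ∀ q : Q, 0 ≤ β q)
    (hsub : ∀ q : Q, (∑ q' : Q, A q q') + β q ≤ 1)
    (hreach : ∀ q : Q, CanReachFinal A β q) :
    (∀ q : Q, Summable fun n : ℕ => ((A ^ n).mulVec β) q) ∧
    (∀ q : Q, (∑' n : ℕ, ((A ^ n).mulVec β) q) =
        (∑ q' : Q, A q q' * ∑' n : ℕ, ((A ^ n).mulVec β) q') + β q) ∧
    (∀ X : Q → ℝ, (∀ q : Q, X q = (∑ q' : Q, A q q' * X q') + β q) →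
        X = fun q => ∑' n : ℕ, ((A ^ n).mulVec β) q) := by
  have hsum (q : Q) : Summable fun n : ℕ => ((A ^ n).mulVec β) q :=
    summable_of_sum_range_le (fun n => pow_mulVec_nonneg hA hβ n q)
      fun n => sum_range_pow_mulVec_le_one hA hsub n q
  have hfix (q : Q) : (∑' n : ℕ, ((A ^ n).mulVec β) q) =
      (∑ q' : Q, A q q' * ∑' n : ℕ, ((A ^ n).mulVec β) q') + β q := by
    rw [(hsum q).tsum_eq_zero_add, add_comm]
    simp only [pow_succ_mulVec_apply, pow_zero, Matrix.one_mulVec]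
    rw [Summable.tsum_finsetSum fun q' _ => (hsum q').mul_left (A q q')]
    simp only [tsum_mul_left]
  refine ⟨hsum, hfix, fun X hX => funext fun q => sub_eq_zero.1 ?_⟩
  refine eq_zero_of_forall_eq_sum_mul hA hβ hsub hreach
    (D := fun r => X r - ∑' n : ℕ, ((A ^ n).mulVec β) r) (fun r => ?_) q
  simp only [mul_sub, Finset.sum_sub_distrib]
  linarith [hX r, hfix r]
end

section
/- Assume that for every q : Q the row sums are exactly 1, i.e. (∑_{q'} A q q') + β q = 1 (the automaton is fully probabilistic), and that every state can reach a final state. Then for every q : Q, ∑'_{n : ℕ} ((A ^ n).mulVec β) q = 1; that is, the probability of the set of all finite complete runs from any state of a fully probabilistic finite automaton equals 1, so the run probability is a discrete distribution on the set of complete runs. (Claim of Section 2.3 of the paper.) -/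
/-- If row `q` of `A` together with `β q` sums to one, a fixed point of `A` attaining a positive
maximum at `q` has no termination weight at `q` and is constant on the successors of `q`. -/
lemma termination_eq_zero_and_successor_eq {Q : Type*} [Fintype Q] {A : Matrix Q Q ℝ} {β v : Q → ℝ}
    {q : Q} (hA : ∀ q', 0 ≤ A q q') (hβ : 0 ≤ β q) (hstoch : (∑ q', A q q') + β q = 1)
    (hfix : A.mulVec v q = v q) (hmax : ∀ q', v q' ≤ v q) (hpos : 0 < v q) :
    β q = 0 ∧ ∀ q', 0 < A q q' → v q' = v q := by
  have hterm : ∀ q' ∈ Finset.univ, 0 ≤ A q q' * (v q - v q') := fun q' _ =>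
    mul_nonneg (hA q') (sub_nonneg.2 (hmax q'))
  have hnonneg := Finset.sum_nonneg hterm
  have hsum : (∑ q', A q q' * (v q - v q')) + β q * v q = 0 := by
    have hfix' : ∑ q', A q q' * v q' = v q := hfix
    simp only [mul_sub, Finset.sum_sub_distrib, ← Finset.sum_mul, hfix']
    linear_combination v q * hstoch
  have hβv : 0 ≤ β q * v q := mul_nonneg hβ hpos.le
  have hβ0 : β q * v q = 0 := by linarith
  have hsum0 : ∑ q', A q q' * (v q - v q') = 0 := by linarith
  refine ⟨(mul_eq_zero.1 hβ0).resolve_right hpos.ne', fun q' hq' => ?_⟩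
  have h0 := (Finset.sum_eq_zero_iff_of_nonneg hterm).1 hsum0 q' (Finset.mem_univ q')
  have := (mul_eq_zero.1 h0).resolve_left hq'.ne'
  linarith

/-- When every state can reach a final state, fixed points of the transition matrix are
nonpositive. -/
lemma nonpos_of_mulVec_eq_self {Q : Type*} [Fintype Q] {A : Matrix Q Q ℝ} {β v : Q → ℝ}
    (hA : ∀ q q', 0 ≤ A q q') (hβ : ∀ q, 0 ≤ β q) (hstoch : ∀ q, (∑ q', A q q') + β q = 1)
    (hreach : ∀ q, CanReachFinal A β q) (hfix : A.mulVec v = v) (q : Q) : v q ≤ 0 := by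
  have : Nonempty Q := ⟨q⟩
  obtain ⟨p, hp⟩ := Finite.exists_max v
  refine (hp q).trans (not_lt.1 fun hpos => ?_)
  have hstep : ∀ r, v r = v p → β r = 0 ∧ ∀ r', 0 < A r r' → v r' = v p := fun r hr => by
    rw [← hr]
    exact termination_eq_zero_and_successor_eq (hA r) (hβ r) (hstoch r) (congrFun hfix r)
      (fun r' => hr ▸ hp r') (hr ▸ hpos)
  obtain ⟨m, f, hf0, hf, hfm⟩ := hreach p
  have hpath : ∀ i ≤ m, v (f i) = v p := by
    intro i
    induction i with
    | zero => intro _; rw [hf0]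
    | succ i ih => intro hi; exact (hstep _ (ih (by omega))).2 _ (hf i hi)
  exact hfm.ne' (hstep _ (hpath m le_rfl)).1

/-- Section 2.3: in a fully probabilistic finite automaton in which every state can
reach a final state, the probability of the set of all finite complete runs from any
state equals 1. -/
theorem fully_probabilistic_total_run_probability
    {Q : Type*} [Fintype Q] [DecidableEq Q] [Nonempty Q]
    (A : Matrix Q Q ℝ) (β : Q → ℝ)
    (hA : ∀ q q' : Q, 0 ≤ A q q') (hβ : ∀ q : Q, 0 ≤ β q)
    (hstoch : ∀ q : Q, (∑ q' : Q, A q q') + β q = 1)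
    (hreach : ∀ q : Q, CanReachFinal A β q) :
    ∀ q : Q, (∑' n : ℕ, ((A ^ n).mulVec β) q) = 1 := by
  have hβ_eq : β = 1 - A.mulVec 1 := by
    ext q
    simp only [Pi.sub_apply, Pi.one_apply, Matrix.mulVec, dotProduct, mul_one]
    linarith [hstoch q]
  have hpow : ∀ n q q', 0 ≤ (A ^ n) q q' := by
    intro n
    induction n with
    | zero => intro q q'; rw [pow_zero, Matrix.one_apply]; split_ifs <;> norm_num
    | succ n ih =>
      intro q q'
      rw [pow_succ, Matrix.mul_apply]
      exact Finset.sum_nonneg fun r _ => mul_nonneg (ih q r) (hA r q')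
  have hterm : ∀ n q, 0 ≤ ((A ^ n).mulVec β) q := fun n q =>
    Finset.sum_nonneg fun r _ => mul_nonneg (hpow n q r) (hβ r)
  have hdiff : ∀ n q, ((A ^ n).mulVec β) q = ((A ^ n).mulVec 1) q - ((A ^ (n + 1)).mulVec 1) q := by
    intro n q
    rw [hβ_eq, Matrix.mulVec_sub, Matrix.mulVec_mulVec, ← pow_succ, Pi.sub_apply]
  have hpartial : ∀ N q, ∑ n ∈ Finset.range N, ((A ^ n).mulVec β) q = 1 - ((A ^ N).mulVec 1) q := by
    intro N q
    simp only [hdiff]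
    rw [Finset.sum_range_sub']
    simp
  have hsummable : ∀ q, Summable fun n => ((A ^ n).mulVec β) q := fun q => by
    refine summable_of_sum_range_le (c := 1) (fun n => hterm n q) fun N => ?_
    rw [hpartial, sub_le_self_iff]
    exact Finset.sum_nonneg fun r _ => mul_nonneg (hpow N q r) zero_le_one
  let v : Q → ℝ := fun q => 1 - ∑' n, ((A ^ n).mulVec β) q
  have hlim : Filter.Tendsto (fun N => (A ^ N).mulVec 1) Filter.atTop (nhds v) := by
    refine tendsto_pi_nhds.2 fun q => ?_
    have h := (hsummable q).hasSum.tendsto_sum_nat.const_sub 1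
    simpa only [hpartial, sub_sub_cancel] using h
  have hfix : A.mulVec v = v := by
    have hcont : Continuous fun w : Q → ℝ => A.mulVec w := by fun_prop
    refine tendsto_nhds_unique ((hcont.tendsto v).comp hlim) ?_
    refine ((Filter.tendsto_add_atTop_iff_nat 1).2 hlim).congr fun N => ?_
    rw [Function.comp_apply, Matrix.mulVec_mulVec, ← pow_succ']
  intro q
  have hle : v q ≤ 0 := nonpos_of_mulVec_eq_self hA hβ hstoch hreach hfix q
  have hge : 0 ≤ v q := ge_of_tendsto' (tendsto_pi_nhds.1 hlim q) fun N =>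
    Finset.sum_nonneg fun r _ => mul_nonneg (hpow N q r) zero_le_one
  have hv : v q = 1 - ∑' n, ((A ^ n).mulVec β) q := rfl
  linarith
end

section
/- For every substochastic automaton A and every deterministic finite automaton 𝒦 over the alphabet Q × Σ × Q recognizing the language K, the probability of the set of complete runs of A whose transition word belongs to K equals the total probability of all complete runs of the synchronized product A‖𝒦: ∑_{ρ a complete run of A with tr(ρ) ∈ K} P_A(ρ) = ∑_{ρ' a complete run of A‖𝒦} P_{A‖𝒦}(ρ'). (Lemma 2 of the paper.) -/
open scoped ENNReal NNReal

/-- A substochastic automaton over an alphabet `S` with state space `Q`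
(the substochasticity condition is stated as a hypothesis of the theorem below):
`Δ q (Sum.inl (a, q'))` is the probability of the transition `q →a q'` and
`Δ q (Sum.inr ())` is the probability of the termination action √ in state `q`. -/
structure SubstochasticAutomaton (S Q : Type*) where
  Δ : Q → ((S × Q) ⊕ Unit) → ℝ≥0
  init : Q

namespace SubstochasticAutomaton

variable {S Q : Type*}

/-- The probability of the complete run starting at `q` whose successive steps are
recorded in the list: `P(q√) = Δ q √` and `P(q →a ρ) = Δ q (a, fst ρ) · P(ρ)`. -/
noncomputable def runProb (A : SubstochasticAutomaton S Q) : Q → List (S × Q) → ℝ≥0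
  | q, [] => A.Δ q (Sum.inr ())
  | q, (a, q') :: rest => A.Δ q (Sum.inl (a, q')) * A.runProb q' rest

/-- The transition word of a run, a word over the alphabet `Q × S × Q`. -/
def trWord : Q → List (S × Q) → List (Q × S × Q)
  | _, [] => []
  | q, (a, q') :: rest => (q, a, q') :: trWord q' rest

open Classical in
/-- The synchronized product of a substochastic automaton with a deterministic
finite automaton over the alphabet `Q × S × Q`. -/
noncomputable def prod {QK : Type*} (A : SubstochasticAutomaton S Q)
    (d : DFA (Q × S × Q) QK) : SubstochasticAutomaton S (Q × QK) where
  Δ := fun p x =>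
    match x with
    | Sum.inl (a, p') =>
        if d.step p.2 (p.1, a, p'.1) = p'.2 then A.Δ p.1 (Sum.inl (a, p'.1)) else 0
    | Sum.inr _ => if p.2 ∈ d.accept then A.Δ p.1 (Sum.inr ()) else 0
  init := (A.init, d.start)

end SubstochasticAutomaton

namespace SubstochasticAutomaton

/-- The lift of a run of `A` from `q` to the synchronized product: the second components are
the states that the automaton `d`, started in `r`, visits while reading the transition word. -/
def liftRun {S Q QK : Type*} (d : DFA (Q × S × Q) QK) :
    Q → QK → List (S × Q) → List (S × (Q × QK))
  | _, _, [] => []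
  | q, r, (a, q') :: rest =>
      (a, (q', d.step r (q, a, q'))) :: liftRun d q' (d.step r (q, a, q')) rest

/-- The projection of a run of the synchronized product to a run of `A`. -/
def projRun {S Q QK : Type*} (ρ : List (S × (Q × QK))) : List (S × Q) :=
  ρ.map fun x => (x.1, x.2.1)

theorem projRun_liftRun {S Q QK : Type*} (d : DFA (Q × S × Q) QK) (q : Q) (r : QK)
    (ρ : List (S × Q)) : projRun (liftRun d q r ρ) = ρ := by
  induction ρ generalizing q r with
  | nil => rfl
  | cons x rest ih =>
    have := ih x.2 (d.step r (q, x.1, x.2))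
    simp_all [liftRun, projRun]

theorem liftRun_injective {S Q QK : Type*} (d : DFA (Q × S × Q) QK) (q : Q) (r : QK) :
    Function.Injective (liftRun d q r) :=
  Function.LeftInverse.injective (projRun_liftRun d q r)

open Classical in
theorem runProb_prod_liftRun {S Q QK : Type*} (A : SubstochasticAutomaton S Q)
    (d : DFA (Q × S × Q) QK) (q : Q) (r : QK) (ρ : List (S × Q)) :
    (A.prod d).runProb (q, r) (liftRun d q r ρ) =
      if d.evalFrom r (trWord q ρ) ∈ d.accept then A.runProb q ρ else 0 := by
  induction ρ generalizing q r with
  | nil => by_cases h : r ∈ d.accept <;> simp [liftRun, runProb, trWord, prod, h]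
  | cons x rest ih =>
    obtain ⟨a, q'⟩ := x
    have hΔ : (A.prod d).Δ (q, r) (Sum.inl (a, (q', d.step r (q, a, q')))) =
        A.Δ q (Sum.inl (a, q')) := by simp [prod]
    by_cases h : d.evalFrom (d.step r (q, a, q')) (trWord q' rest) ∈ d.accept <;>
      simp [liftRun, runProb, trWord, ih, hΔ, h]

theorem liftRun_projRun_of_runProb_ne_zero {S Q QK : Type*} (A : SubstochasticAutomaton S Q)
    (d : DFA (Q × S × Q) QK) (q : Q) (r : QK) (ρ : List (S × (Q × QK)))
    (h : (A.prod d).runProb (q, r) ρ ≠ 0) : liftRun d q r (projRun ρ) = ρ := by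
  induction ρ generalizing q r with
  | nil => rfl
  | cons x rest ih =>
    obtain ⟨a, q', r'⟩ := x
    simp only [runProb] at h
    have hΔ := left_ne_zero_of_mul h
    have hstep : d.step r (q, a, q') = r' := by
      by_contra hne
      exact hΔ (by simp [prod, hne])
    have hrest := ih q' r' (right_ne_zero_of_mul h)
    simp_all [liftRun, projRun]

end SubstochasticAutomaton

/-- Lemma 2: the probability of the set of complete runs of a substochastic
automaton `A` whose transition word belongs to the language recognized by a
deterministic finite automaton `d` equals the total probability of all complete
runs of the synchronized product `A ‖ d`. -/
theorem synchronized_product_probability {S Q QK : Type*}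
    [Fintype S] [Fintype Q] [Fintype QK]
    (A : SubstochasticAutomaton S Q)
    (hA : ∀ q : Q, ∑ x : (S × Q) ⊕ Unit, A.Δ q x ≤ 1)
    (d : DFA (Q × S × Q) QK) :
    ∑' ρ : {ρ : List (S × Q) // SubstochasticAutomaton.trWord A.init ρ ∈ d.accepts},
        ((A.runProb A.init ρ : ℝ≥0) : ℝ≥0∞) =
    ∑' ρ : List (S × (Q × QK)),
        (((A.prod d).runProb (A.prod d).init ρ : ℝ≥0) : ℝ≥0∞) := by
  classical
  have hsupp : Function.support (fun ρ : List (S × (Q × QK)) =>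
      (((A.prod d).runProb (A.prod d).init ρ : ℝ≥0) : ℝ≥0∞)) ⊆
      Set.range (SubstochasticAutomaton.liftRun d A.init d.start) := fun ρ hρ =>
    ⟨SubstochasticAutomaton.projRun ρ,
      A.liftRun_projRun_of_runProb_ne_zero d A.init d.start ρ fun h =>
        hρ (ENNReal.coe_eq_zero.mpr h)⟩
  rw [← (SubstochasticAutomaton.liftRun_injective d A.init d.start).tsum_eq hsupp]
  refine (tsum_subtype {ρ | SubstochasticAutomaton.trWord A.init ρ ∈ d.accepts}
    (fun ρ => ((A.runProb A.init ρ : ℝ≥0) : ℝ≥0∞))).trans (tsum_congr fun ρ => ?_)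
  have h := A.runProb_prod_liftRun d A.init d.start ρ
  change (A.prod d).runProb (A.prod d).init _ = _ at h
  rw [h, Set.indicator_apply]
  simp only [Set.mem_ofPred_eq, DFA.mem_accepts, DFA.eval]
  split_ifs <;> simp
end

section
/- Let f(p) = 25p² − 25p + 58. For every real p with 0 ≤ p ≤ 1 one has 7·f(p) − 5p − 49 > 0 and 7·f(p) − 30p − 14 > 0, and ( 1/8 + (49/8)·f(p)·( p/(7·f(p) − 5p − 49) + (1 − p)/(7·f(p) − 30p − 14) ) )⁻¹ > 88192/146509. (This is the analytic content of Theorem 3 of the paper: the left-hand side is the restrictive probabilistic opacity of the nondeterministic probabilistic automaton B of Figure 12 scheduled by the memoryless scheduler with parameter p, and 88192/146509 is its restrictive probabilistic opacity under the memory scheduler σ_m; hence the minimal restrictive probabilistic opacity of B cannot be reached by any memoryless scheduler.) -/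
/-- Theorem 3 (analytic content): for every `p ∈ [0,1]`, with
`f p = 25p² − 25p + 58`, the denominators `7·f p − 5p − 49` and `7·f p − 30p − 14`
are positive, and the restrictive probabilistic opacity of the automaton `B`
scheduled by the memoryless scheduler `σ_p`, namely
`(1/8 + (49/8)·f p·(p/(7·f p − 5p − 49) + (1 − p)/(7·f p − 30p − 14)))⁻¹`,
always exceeds the value `88192/146509` achieved by the memory scheduler `σ_m`;
hence no memoryless scheduler attains the minimal restrictive opacity of `B`. -/
theorem memoryless_rpo_exceeds_memory_value :
    ∀ p : ℝ, 0 ≤ p → p ≤ 1 →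
      0 < 7 * (25 * p ^ 2 - 25 * p + 58) - 5 * p - 49 ∧
      0 < 7 * (25 * p ^ 2 - 25 * p + 58) - 30 * p - 14 ∧
      (1 / 8 + (49 / 8) * (25 * p ^ 2 - 25 * p + 58) *
          (p / (7 * (25 * p ^ 2 - 25 * p + 58) - 5 * p - 49) +
           (1 - p) / (7 * (25 * p ^ 2 - 25 * p + 58) - 30 * p - 14)))⁻¹
        > 88192 / 146509 := by
  intro p hp0 hp1
  have hf : 51 ≤ 25 * p ^ 2 - 25 * p + 58 := by nlinarith [sq_nonneg (2 * p - 1)]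
  generalize 25 * p ^ 2 - 25 * p + 58 = f at hf ⊢
  have hA : 0 < 7 * f - 5 * p - 49 := by linarith
  have hB : 0 < 7 * f - 30 * p - 14 := by linarith
  have hf0 : 0 < f := by linarith
  have hq0 : 0 ≤ 1 - p := by linarith
  refine ⟨hA, hB, ?_⟩
  have hp : p / (7 * f - 5 * p - 49) ≤ p / (5 * f) :=
    div_le_div_of_nonneg_left hp0 (by positivity) (by linarith)
  have hq : (1 - p) / (7 * f - 30 * p - 14) ≤ (1 - p) / (5 * f) :=
    div_le_div_of_nonneg_left hq0 (by positivity) (by linarith)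
  have hsum : f * (p / (7 * f - 5 * p - 49) + (1 - p) / (7 * f - 30 * p - 14)) ≤ 1 / 5 :=
    calc
      _ ≤ f * (p / (5 * f) + (1 - p) / (5 * f)) := by gcongr
      _ = 1 / 5 := by field_simp; ring
  rw [gt_iff_lt, lt_inv_comm₀ (by norm_num) (by positivity), mul_assoc]
  linarith
end

section
/- The Crowds linear system has a unique solution, given by: L_j = q/n for every 1 ≤ j ≤ n−c−1, L_{n−c} = 1 − q·(n−c−1)/n, L_{1'} = 1/n, L_0 = 1/((n−c)·n), L_j = 1 for every n−c+1 ≤ j ≤ n, and L_S = 1. In particular, the probability that user 1 initiates the Crowds protocol while user n−c is detected by the adversary equals L_0 = 1/((n−c)·n). (Appendix B of the paper, solving the system of Table 5.) -/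
/-- The Crowds linear system (Table 5 of the paper) for `n` users among whom `c` are
corrupt and forwarding probability `q`, with unknowns `L0`, `L1'`, `LS` and
`L 1, …, L n`. -/
def CrowdsSystem (n c : ℕ) (q : ℝ) (L0 L1' LS : ℝ) (L : ℕ → ℝ) : Prop :=
  L0 = (1 / ((n : ℝ) - c)) * L1' ∧
  L1' = ∑ i ∈ Finset.Icc 1 (n - c), (1 / (n : ℝ)) * L i ∧
  (∀ j, 1 ≤ j → j ≤ n - c - 1 → L j = ∑ i ∈ Finset.Icc 1 (n - c), (q / (n : ℝ)) * L i) ∧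
  L (n - c) = (1 - q) * LS + ∑ i ∈ Finset.Icc 1 n, (q / (n : ℝ)) * L i ∧
  (∀ j, n - c + 1 ≤ j → j ≤ n → L j = 1) ∧
  LS = 1

/-- Over the honest users, a family constant on `1, …, k` sums to `k` times the constant plus
its last value. -/
theorem sum_Icc_succ_of_const {L : ℕ → ℝ} {a : ℝ} {k : ℕ}
    (h : ∀ j, 1 ≤ j → j ≤ k → L j = a) :
    ∑ i ∈ Finset.Icc 1 (k + 1), L i = k * a + L (k + 1) := by
  rw [Finset.sum_Icc_succ_top (by omega), Finset.sum_congr rfl (g := fun _ => a)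
    (fun j hj => h j (Finset.mem_Icc.1 hj).1 (Finset.mem_Icc.1 hj).2)]
  simp

/-- A family equal to `1` on `m + 1, …, m + c` gains `c` when its sum is extended from
`1, …, m` to `1, …, m + c`. -/
theorem sum_Icc_add_of_one {L : ℕ → ℝ} {m c : ℕ}
    (h : ∀ j, m + 1 ≤ j → j ≤ m + c → L j = 1) :
    ∑ i ∈ Finset.Icc 1 (m + c), L i = ∑ i ∈ Finset.Icc 1 m, L i + c := by
  induction c with
  | zero => simp
  | succ c ih =>
    rw [← add_assoc, Finset.sum_Icc_succ_top (by omega), ih fun j h₁ h₂ => h j h₁ (by omega),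
      h _ (by omega) (by omega)]
    push_cast
    ring

/-- Appendix B: the Crowds linear system has a unique solution, namely
`L_j = q/n` for `1 ≤ j ≤ n−c−1`, `L_{n−c} = 1 − q(n−c−1)/n`, `L_{1'} = 1/n`,
`L_0 = 1/((n−c)·n)`, `L_j = 1` for `n−c+1 ≤ j ≤ n` and `L_S = 1`.
In particular the probability that user 1 initiates the protocol while user `n−c`
is detected equals `L_0 = 1/((n−c)·n)`. -/
theorem crowds_linear_system_solution (n c : ℕ) (hc : c < n)
    (q : ℝ) (hq0 : 0 < q) (hq1 : q < 1) :
    CrowdsSystem n c q (1 / (((n : ℝ) - c) * n)) (1 / (n : ℝ)) 1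
      (fun j => if j ≤ n - c - 1 then q / (n : ℝ)
                else if j = n - c then 1 - q * ((n : ℝ) - c - 1) / n else 1) ∧
    (∀ (L0 L1' LS : ℝ) (L : ℕ → ℝ), CrowdsSystem n c q L0 L1' LS L →
       L0 = 1 / (((n : ℝ) - c) * n) ∧ L1' = 1 / (n : ℝ) ∧ LS = 1 ∧
       (∀ j, 1 ≤ j → j ≤ n - c - 1 → L j = q / (n : ℝ)) ∧
       L (n - c) = 1 - q * ((n : ℝ) - c - 1) / n ∧
       (∀ j, n - c + 1 ≤ j → j ≤ n → L j = 1)) := by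
  obtain ⟨k, rfl⟩ : ∃ k, n = k + 1 + c := ⟨n - c - 1, by omega⟩
  simp only [CrowdsSystem, Nat.add_sub_cancel, ← Finset.mul_sum]
  have hk : (0 : ℝ) < k + 1 := by positivity
  push_cast
  have hsub : (k + 1 + c - c : ℝ) = k + 1 := by ring
  simp only [hsub, add_sub_cancel_right]
  constructor
  · set F : ℕ → ℝ := fun j => if j ≤ k then q / (k + 1 + c : ℝ)
      else if j = k + 1 then 1 - q * k / (k + 1 + c) else 1 with hF
    have h_honest : ∀ j, 1 ≤ j → j ≤ k → F j = q / (k + 1 + c : ℝ) :=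
      fun j _ h => by simp [hF, h]
    have h_last : F (k + 1) = 1 - q * k / (k + 1 + c) := by simp [hF]
    have h_corrupt : ∀ j, k + 1 + 1 ≤ j → j ≤ k + 1 + c → F j = 1 := fun j h _ => by
      simp [hF, show ¬ j ≤ k by omega, show j ≠ k + 1 by omega]
    have h_sum : ∑ i ∈ Finset.Icc 1 (k + 1), F i = 1 := by
      rw [sum_Icc_succ_of_const h_honest, h_last]
      ring
    refine ⟨by field_simp, by rw [h_sum, mul_one],
      fun j h₁ h₂ => by rw [h_sum, mul_one]; exact h_honest j h₁ h₂, ?_, h_corrupt, trivial⟩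
    rw [sum_Icc_add_of_one h_corrupt, h_sum, if_neg (by omega)]
    field_simp
    ring
  · rintro L0 L1' LS L ⟨h0, h1, h_honest, h_last, h_corrupt, rfl⟩
    have h_sum := sum_Icc_succ_of_const h_honest
    rw [sum_Icc_add_of_one h_corrupt] at h_last
    set S := ∑ i ∈ Finset.Icc 1 (k + 1), L i
    have hS : S = 1 := by
      have hpos : 0 < k + 1 + c - q * (k + 1 : ℝ) := by
        nlinarith [mul_pos (sub_pos.2 hq1) hk, Nat.cast_nonneg (α := ℝ) c]
      rw [h_last] at h_sum
      field_simp at h_sum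
      apply mul_left_cancel₀ hpos.ne'
      linarith
    rw [hS] at h1 h_honest h_last
    rw [mul_one] at h1
    refine ⟨?_, h1, rfl, fun j h₁ h₂ => by rw [h_honest j h₁ h₂, mul_one], ?_, h_corrupt⟩
    · rw [h0, h1]
      field_simp
    · rw [h_last]
      field_simp
      ring
end

section
/- For the Crowds protocol distribution, the restrictive probabilistic opacity of the predicate 'user i₀ initiated the request' with respect to the observation of the detected user equals RPO(μ,φ,𝒪) = (n−c)·(n−1)·(n−c−1) / (n·(n² + c² − 2·n·c − n + 2·c)). Moreover, for fixed c, this value tends to 1 as n tends to infinity. (Section 6.3 of the paper.) -/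
open scoped ENNReal Classical

/-- The mass of the part of `A` over `b`, as a sum over the fibre of the second projection. -/
lemma mOf_inter_preimage_snd {α β : Type*} [Fintype α] [Fintype β] (μ : PMF (α × β))
    (A : Set (α × β)) (b : β) :
    mOf μ (A ∩ Prod.snd ⁻¹' {b}) = ∑ a, if (a, b) ∈ A then μ (a, b) else 0 := by
  rw [mOf, tsum_subtype, tsum_fintype, Fintype.sum_prod_type]
  refine Finset.sum_congr rfl fun a _ => ?_
  rw [Finset.sum_eq_single b]
  · simp [Set.indicator_apply]
  · intro x _ hx
    simp [hx]
  · simp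

/-- The Crowds weight of a pair of honest users, among `k` honest and `c` corrupt users. -/
noncomputable def crowdsWeight (c k : ℕ) (i j : Fin k) : ℝ :=
  (if i = j then (c : ℝ) + 1 else 1) / (((c : ℝ) + k) * k)

lemma crowdsWeight_nonneg (c k : ℕ) (i j : Fin k) : 0 ≤ crowdsWeight c k i j := by
  unfold crowdsWeight
  split_ifs <;> positivity

lemma sum_crowdsWeight (c k : ℕ) (hk : 0 < k) (j : Fin k) :
    ∑ i, crowdsWeight c k i j = 1 / k := by
  have h : ∀ i : Fin k, (if i = j then (c : ℝ) + 1 else 1) = (if i = j then (c : ℝ) else 0) + 1 := by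
    intro i
    split_ifs <;> simp
  have hk' : (0 : ℝ) < k := by exact_mod_cast hk
  simp only [crowdsWeight, ← Finset.sum_div, h, Finset.sum_add_distrib]
  simp only [Finset.sum_ite_eq', Finset.mem_univ, if_true, Finset.sum_const, Finset.card_univ,
    Fintype.card_fin, nsmul_eq_mul, mul_one]
  have : (c : ℝ) + k ≠ 0 := by positivity
  field_simp

lemma sum_crowdsWeight_of_ne (c k : ℕ) (hk : 0 < k) (i₀ j : Fin k) :
    (∑ i, if i ≠ i₀ then crowdsWeight c k i j else 0) =
      (if j = i₀ then (k : ℝ) - 1 else (c : ℝ) + k - 1) / (((c : ℝ) + k) * k) := by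
  have hk' : (0 : ℝ) < k := by exact_mod_cast hk
  have h : ∀ i : Fin k, (if i ≠ i₀ then crowdsWeight c k i j else 0) =
      crowdsWeight c k i j - if i = i₀ then crowdsWeight c k i j else 0 := by
    intro i
    by_cases hi : i = i₀ <;> simp [hi]
  simp only [h, Finset.sum_sub_distrib, sum_crowdsWeight c k hk, Finset.sum_ite_eq',
    Finset.mem_univ, if_true]
  have : (c : ℝ) + k ≠ 0 := by positivity
  simp only [crowdsWeight, eq_comm (a := i₀)]
  split_ifs <;> field_simp
  ring

lemma RPO_crowdsWeight (c k : ℕ) (hk : 2 ≤ k) (i₀ : Fin k) (μ : PMF (Fin k × Fin k))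
    (hμ : ∀ i j, μ (i, j) = ENNReal.ofReal (crowdsWeight c k i j)) :
    RPO μ {p : Fin k × Fin k | p.1 = i₀} Prod.snd =
      ENNReal.ofReal ((k * ((c : ℝ) + k - 1) * ((k : ℝ) - 1)) /
        (((c : ℝ) + k) * ((k : ℝ) ^ 2 + c - k))) := by
  have hk' : (2 : ℝ) ≤ k := by exact_mod_cast hk
  have hc : (0 : ℝ) ≤ c := c.cast_nonneg
  have hk1 : (0 : ℝ) < (k : ℝ) - 1 := by linarith
  have hn1 : (0 : ℝ) < (c : ℝ) + k - 1 := by linarith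
  have hn : (0 : ℝ) < (c : ℝ) + k := by linarith
  have hk0 : (0 : ℝ) < k := by linarith
  have hD : (0 : ℝ) < (k : ℝ) ^ 2 + c - k := by nlinarith
  have hpos : ∀ j : Fin k,
      0 < (if j = i₀ then (k : ℝ) - 1 else (c : ℝ) + k - 1) / (((c : ℝ) + k) * k) := by
    intro j
    split_ifs <;> positivity
  have hclass : ∀ j : Fin k, mOf μ (Prod.snd ⁻¹' {j}) = ENNReal.ofReal (1 / k) := by
    intro j
    rw [← Set.univ_inter (Prod.snd ⁻¹' {j}), mOf_inter_preimage_snd,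
      ← sum_crowdsWeight c k (by lia) j,
      ENNReal.ofReal_sum_of_nonneg fun i _ => crowdsWeight_nonneg c k i j]
    simp [hμ]
  have hcompl : ∀ j : Fin k,
      mOf μ ({p : Fin k × Fin k | p.1 = i₀}ᶜ ∩ Prod.snd ⁻¹' {j}) = ENNReal.ofReal
        ((if j = i₀ then (k : ℝ) - 1 else (c : ℝ) + k - 1) / (((c : ℝ) + k) * k)) := by
    intro j
    rw [mOf_inter_preimage_snd, ← sum_crowdsWeight_of_ne c k (by lia) i₀ j,
      ENNReal.ofReal_sum_of_nonneg fun i _ => by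
        split_ifs
        exacts [crowdsWeight_nonneg c k i j, le_rfl]]
    refine Finset.sum_congr rfl fun i _ => ?_
    by_cases hi : i = i₀ <;> simp [hi, hμ]
  have hterm : ∀ j : Fin k, (mOf μ (Prod.snd ⁻¹' {j})) ^ 2 /
      mOf μ ({p : Fin k × Fin k | p.1 = i₀}ᶜ ∩ Prod.snd ⁻¹' {j}) =
        ENNReal.ofReal ((1 / k) ^ 2 /
          ((if j = i₀ then (k : ℝ) - 1 else (c : ℝ) + k - 1) / (((c : ℝ) + k) * k))) := by
    intro j
    rw [hclass, hcompl, ← ENNReal.ofReal_pow (by positivity), ENNReal.ofReal_div_of_pos (hpos j)]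
  have hsplit : ∀ j : Fin k, ((1 : ℝ) / k) ^ 2 /
      ((if j = i₀ then (k : ℝ) - 1 else (c : ℝ) + k - 1) / (((c : ℝ) + k) * k)) =
      ((c : ℝ) + k) / k * (1 / ((c : ℝ) + k - 1)) +
        if j = i₀ then ((c : ℝ) + k) / k * (1 / ((k : ℝ) - 1) - 1 / ((c : ℝ) + k - 1)) else 0 := by
    intro j
    split_ifs <;> field_simp <;> ring
  have hsum : (∑ j : Fin k, ((1 : ℝ) / k) ^ 2 /
      ((if j = i₀ then (k : ℝ) - 1 else (c : ℝ) + k - 1) / (((c : ℝ) + k) * k))) =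
      (((c : ℝ) + k) * ((k : ℝ) ^ 2 + c - k)) / (k * ((c : ℝ) + k - 1) * ((k : ℝ) - 1)) := by
    simp only [hsplit, Finset.sum_add_distrib, Finset.sum_ite_eq', Finset.mem_univ, if_true,
      Finset.sum_const, Finset.card_univ, Fintype.card_fin, nsmul_eq_mul]
    field_simp
    ring
  rw [RPO, tsum_fintype]
  simp only [hterm]
  rw [← ENNReal.ofReal_sum_of_nonneg fun j _ => div_nonneg (by positivity) (hpos j).le, hsum,
    ← ENNReal.ofReal_inv_of_pos (by positivity), inv_div]

open Filter in
lemma tendsto_crowds_rpo (c : ℝ) :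
    Tendsto
      (fun m : ℕ =>
        (((m : ℝ) - c) * ((m : ℝ) - 1) * ((m : ℝ) - c - 1)) /
          ((m : ℝ) * ((m : ℝ) ^ 2 + c ^ 2 - 2 * m * c - m + 2 * c)))
      atTop (nhds 1) := by
  have hinv : Tendsto (fun m : ℕ => ((m : ℝ))⁻¹) atTop (nhds 0) :=
    tendsto_inv_atTop_nhds_zero_nat
  have hcont : ContinuousAt (fun x : ℝ => ((1 - c * x) * (1 - x) * (1 - c * x - x)) /
      (1 + c ^ 2 * x ^ 2 - 2 * c * x - x + 2 * c * x ^ 2)) 0 :=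
    ContinuousAt.div (by fun_prop) (by fun_prop) (by simp)
  have hlim := hcont.tendsto.comp hinv
  simp only [mul_zero, sub_zero, mul_one, ne_eq, OfNat.ofNat_ne_zero, not_false_eq_true,
    zero_pow, add_zero, div_one] at hlim
  refine hlim.congr' ?_
  filter_upwards [eventually_gt_atTop 0] with m hm
  have hm' : (m : ℝ) ≠ 0 := by positivity
  have h3 : (m : ℝ) ^ 3 ≠ 0 := pow_ne_zero 3 hm'
  rw [Function.comp_apply, ← mul_div_mul_left _ _ h3]
  congr 1 <;> field_simp

open Filter in
/-- Section 6.3: for the Crowds protocol with n users among whom c are corrupt, the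
restrictive probabilistic opacity of the predicate "user i₀ initiated the request"
with respect to the observation of the detected user equals
(n−c)(n−1)(n−c−1) / (n(n² + c² − 2nc − n + 2c)), and for fixed c this value tends
to 1 as n tends to infinity. -/
theorem crowds_rpo (n c : ℕ) (hn : c + 2 ≤ n)
    (i₀ : Fin (n - c)) (μ : PMF (Fin (n - c) × Fin (n - c)))
    (hμ : ∀ i j : Fin (n - c),
      μ (i, j) = (if i = j then ((c : ℝ≥0∞) + 1) else 1) /
        ((n : ℝ≥0∞) * ((n - c : ℕ) : ℝ≥0∞))) :
    RPO μ {p : Fin (n - c) × Fin (n - c) | p.1 = i₀} Prod.snd =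
      ENNReal.ofReal
        ((((n : ℝ) - c) * ((n : ℝ) - 1) * ((n : ℝ) - c - 1)) /
          ((n : ℝ) * ((n : ℝ) ^ 2 + (c : ℝ) ^ 2 - 2 * n * c - n + 2 * c))) ∧
    Tendsto
      (fun m : ℕ =>
        (((m : ℝ) - c) * ((m : ℝ) - 1) * ((m : ℝ) - c - 1)) /
          ((m : ℝ) * ((m : ℝ) ^ 2 + (c : ℝ) ^ 2 - 2 * m * c - m + 2 * c)))
      atTop (nhds 1) := by
  have hcast : ((n - c : ℕ) : ℝ) = n - c := Nat.cast_sub (by lia)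
  refine ⟨?_, tendsto_crowds_rpo c⟩
  rw [RPO_crowdsWeight c (n - c) (by lia) i₀ μ, hcast]
  · congr 1
    ring
  · intro i j
    have hpos : (0 : ℝ) < (n : ℝ) * ((n - c : ℕ) : ℝ) := by
      have h₁ : 0 < n := by lia
      have h₂ : 0 < n - c := by lia
      positivity
    have hadd : (c : ℝ) + ((n - c : ℕ) : ℝ) = n := by rw [hcast]; ring
    rw [hμ, crowdsWeight, hadd, ENNReal.ofReal_div_of_pos hpos,
      ENNReal.ofReal_mul n.cast_nonneg, ENNReal.ofReal_natCast, ENNReal.ofReal_natCast]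
    congr 1
    split_ifs
    · rw [ENNReal.ofReal_add c.cast_nonneg zero_le_one, ENNReal.ofReal_natCast,
        ENNReal.ofReal_one]
    · exact ENNReal.ofReal_one.symm
end

section
/- For the sale protocol distribution, the restrictive probabilistic symmetric opacity of the buyer's identity with respect to the public price equals RPSO(μ,φ,𝒪) = −1 / ( α·log₂(min(β, 1−β)) + (1−α)·log₂(min(γ, 1−γ)) ). (Section 4.2, Example 1 of the paper.) -/
open scoped ENNReal Classical

theorem mOf_eq_sum {R : Type*} [Fintype R] (μ : PMF R) (S : Set R) :
    mOf μ S = ∑ x, S.indicator μ x := by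
  rw [mOf, tsum_subtype S μ, tsum_fintype]

theorem mOf_fst_fiber {a t : ℝ} (ha : 0 < a) (ht0 : 0 < t) (ht1 : t < 1)
    (μ : PMF (Bool × Bool)) (o : Bool)
    (hp : μ (o, true) = ENNReal.ofReal (a * t))
    (hr : μ (o, false) = ENNReal.ofReal (a * (1 - t))) :
    mOf μ (Prod.fst ⁻¹' {o}) = ENNReal.ofReal a := by
  have hsum : mOf μ (Prod.fst ⁻¹' {o}) = μ (o, true) + μ (o, false) := by
    cases o <;> simp [mOf_eq_sum, Fintype.sum_prod_type, Set.indicator]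
  rw [hsum, hp, hr, ← ENNReal.ofReal_add (by positivity) (mul_nonneg ha.le (by linarith))]
  congr 1
  ring

theorem vul_snd_fst {a t : ℝ} (ha : 0 < a) (ht0 : 0 < t) (ht1 : t < 1)
    (μ : PMF (Bool × Bool)) (o : Bool)
    (hp : μ (o, true) = ENNReal.ofReal (a * t))
    (hr : μ (o, false) = ENNReal.ofReal (a * (1 - t))) :
    Vul μ {x : Bool × Bool | x.2 = true} Prod.fst o = ENNReal.ofReal (max t (1 - t)) := by
  have hpoor : mOf μ ({x : Bool × Bool | x.2 = true} ∩ Prod.fst ⁻¹' {o}) = μ (o, true) := by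
    cases o <;> simp [mOf_eq_sum, Fintype.sum_prod_type, Set.indicator]
  have hrich : mOf μ ({x : Bool × Bool | x.2 = true}ᶜ ∩ Prod.fst ⁻¹' {o}) = μ (o, false) := by
    cases o <;> simp [mOf_eq_sum, Fintype.sum_prod_type, Set.indicator]
  rw [Vul, hpoor, hrich, mOf_fst_fiber ha ht0 ht1 μ o hp hr, hp, hr, ← ENNReal.ofReal_max,
    ← ENNReal.ofReal_div_of_pos ha, ← mul_max_of_nonneg _ _ ha.le, mul_div_cancel_left₀ _ ha.ne']

theorem rpso_summand_snd_fst {a t : ℝ} (ha : 0 < a) (ht0 : 0 < t) (ht1 : t < 1)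
    (μ : PMF (Bool × Bool)) (o : Bool)
    (hp : μ (o, true) = ENNReal.ofReal (a * t))
    (hr : μ (o, false) = ENNReal.ofReal (a * (1 - t))) :
    mOf μ (Prod.fst ⁻¹' {o}) *
      (if Vul μ {x : Bool × Bool | x.2 = true} Prod.fst o = 1 then ⊤
       else ENNReal.ofReal
        (- Real.logb 2 ((1 - Vul μ {x : Bool × Bool | x.2 = true} Prod.fst o).toReal))) =
      ENNReal.ofReal (a * -Real.logb 2 (min t (1 - t))) := by
  have hlt : max t (1 - t) < 1 := max_lt ht1 (by linarith)
  have hmin : 1 - max t (1 - t) = min t (1 - t) := by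
    linarith [min_add_max t (1 - t)]
  rw [vul_snd_fst ha ht0 ht1 μ o hp hr, mOf_fst_fiber ha ht0 ht1 μ o hp hr,
    if_neg (mt ENNReal.ofReal_eq_one.1 hlt.ne), ← ENNReal.ofReal_one,
    ← ENNReal.ofReal_sub _ (le_max_of_le_left ht0.le), ENNReal.toReal_ofReal (by linarith), hmin,
    ENNReal.ofReal_mul ha.le]

theorem logb_two_min_one_sub_neg {t : ℝ} (ht0 : 0 < t) (ht1 : t < 1) :
    Real.logb 2 (min t (1 - t)) < 0 :=
  Real.logb_neg one_lt_two (lt_min ht0 (by linarith)) (min_lt_of_left_lt ht1)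

/-- Section 4.2, Example 1 (sale protocol): the restrictive probabilistic symmetric
opacity of the buyer's identity (poor/rich) with respect to the public price
(cheap/expensive) equals −1/(α·log₂(min(β,1−β)) + (1−α)·log₂(min(γ,1−γ))). -/
theorem sale_protocol_rpso (α β γ : ℝ)
    (hα0 : 0 < α) (hα1 : α < 1) (hβ0 : 0 < β) (hβ1 : β < 1) (hγ0 : 0 < γ) (hγ1 : γ < 1)
    (μ : PMF (Bool × Bool))
    (hμ : ∀ cheap poor : Bool,
      μ (cheap, poor) =
        ENNReal.ofReal
          (if cheap then α * (if poor then β else 1 - β)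
           else (1 - α) * (if poor then γ else 1 - γ))) :
    RPSO μ {x : Bool × Bool | x.2 = true} Prod.fst =
      ENNReal.ofReal
        (-1 / (α * Real.logb 2 (min β (1 - β)) +
               (1 - α) * Real.logb 2 (min γ (1 - γ)))) := by
  have hβ := logb_two_min_one_sub_neg hβ0 hβ1
  have hγ := logb_two_min_one_sub_neg hγ0 hγ1
  have hα : 0 < 1 - α := by linarith
  have hcheap := mul_pos hα0 (neg_pos.2 hβ)
  have hexp := mul_pos hα (neg_pos.2 hγ)
  rw [RPSO, tsum_fintype, Fintype.sum_bool,
    rpso_summand_snd_fst hα0 hβ0 hβ1 μ true (by simp [hμ]) (by simp [hμ]),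
    rpso_summand_snd_fst hα hγ0 hγ1 μ false (by simp [hμ]) (by simp [hμ]),
    ← ENNReal.ofReal_add hcheap.le hexp.le, ← ENNReal.ofReal_inv_of_pos (add_pos hcheap hexp)]
  congr 1
  rw [mul_neg, mul_neg, ← neg_add, inv_neg, neg_div, one_div]
end

section
/- For the program P₁ that reveals a uniformly random 8k-bit secret exactly when it is divisible by 8 (and outputs −1 otherwise), the liberal probabilistic opacity of the predicate 'the secret equals the output' is LPO(μ,φ,𝒪) = 1/8, and its liberal probabilistic symmetrical opacity is LPSO(μ,φ,𝒪) = 1. (Section 6.2, Table 7 of the paper.) -/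
open scoped ENNReal Classical

/-- The observation function of program P₁: the secret H is output in clear when it
is divisible by 8, and the output is −1 (the Unit observable) otherwise. -/
def p1Obs (k : ℕ) :
    Fin (2 ^ (8 * k)) → ({m : Fin (2 ^ (8 * k)) // 8 ∣ (m : ℕ)} ⊕ Unit) :=
  fun H => if h : 8 ∣ (H : ℕ) then Sum.inl ⟨H, h⟩ else Sum.inr ()

theorem mOf_eq_tsum_ite {R : Type*} (μ : PMF R) (S : Set R) :
    mOf μ S = ∑' ρ : R, if ρ ∈ S then μ ρ else 0 := by
  simp only [mOf, tsum_subtype S (fun ρ => μ ρ), Set.indicator_apply]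

theorem mOf_add_mOf_compl {R : Type*} (μ : PMF R) (S : Set R) :
    mOf μ S + mOf μ Sᶜ = 1 := by
  rw [mOf_eq_tsum_ite, mOf_eq_tsum_ite, ← ENNReal.tsum_add, ← μ.tsum_coe]
  refine tsum_congr fun ρ => ?_
  by_cases h : ρ ∈ S <;> simp [h]

/-- The liberal opacity of a union of observation classes is its probability. -/
theorem LPO_preimage {R Obs : Type*} (μ : PMF R) (O : R → Obs) (ψ : Set Obs) :
    LPO μ (O ⁻¹' ψ) O = mOf μ (O ⁻¹' ψ) := by
  have hfiber (o : Obs) : (if O ⁻¹' {o} ⊆ O ⁻¹' ψ then mOf μ (O ⁻¹' {o}) else 0) =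
      ∑' ρ : R, if o = O ρ then (if ρ ∈ O ⁻¹' ψ then μ ρ else 0) else 0 := by
    split_ifs with h
    · rw [mOf_eq_tsum_ite]
      refine tsum_congr fun ρ => ?_
      by_cases hρ : O ρ = o
      · have hmem : ρ ∈ O ⁻¹' ψ := h hρ
        rw [if_pos (show ρ ∈ O ⁻¹' {o} from hρ), if_pos hρ.symm, if_pos hmem]
      · rw [if_neg (show ρ ∉ O ⁻¹' {o} from hρ), if_neg (Ne.symm hρ)]
    · have ho : o ∉ ψ := fun ho => h (Set.preimage_mono (Set.singleton_subset_iff.2 ho))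
      symm
      refine ENNReal.tsum_eq_zero.2 fun ρ => ?_
      split_ifs with h₁ h₂
      · exact absurd (h₁ ▸ h₂) ho
      · rfl
      · rfl
  rw [LPO, tsum_congr hfiber, ENNReal.tsum_comm, mOf_eq_tsum_ite]
  exact tsum_congr fun ρ => tsum_ite_eq (O ρ) _

theorem sum_range_ite_eight_dvd (n : ℕ) (c : ℝ≥0∞) :
    ∑ i ∈ Finset.range (8 * n), (if 8 ∣ i then c else 0) = n * c := by
  induction n with
  | zero => simp
  | succ n ih =>
    rw [Nat.mul_succ, Finset.sum_range_add, ih]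
    simp [Finset.sum_range_succ, Nat.dvd_add_right, add_mul]

theorem preimage_p1Obs_isLeft (k : ℕ) :
    p1Obs k ⁻¹' {o | o.isLeft} = {H : Fin (2 ^ (8 * k)) | 8 ∣ (H : ℕ)} := by
  ext H
  by_cases h : 8 ∣ (H : ℕ) <;> simp [p1Obs, h]

/-- Section 6.2, Table 7 (program P₁): for a uniformly random 8k-bit secret revealed
exactly when divisible by 8, the liberal probabilistic opacity of "the secret equals
the output" is 1/8 and the liberal probabilistic symmetrical opacity is 1. -/
theorem program_p1_liberal_opacities (k : ℕ) (hk : 1 ≤ k)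
    (μ : PMF (Fin (2 ^ (8 * k))))
    (hμ : ∀ ρ : Fin (2 ^ (8 * k)), μ ρ = ((2 ^ (8 * k) : ℕ) : ℝ≥0∞)⁻¹) :
    LPO μ {H : Fin (2 ^ (8 * k)) | 8 ∣ (H : ℕ)} (p1Obs k) = 1 / 8 ∧
    LPSO μ {H : Fin (2 ^ (8 * k)) | 8 ∣ (H : ℕ)} (p1Obs k) = 1 := by
  constructor
  · rw [← preimage_p1Obs_isLeft, LPO_preimage, preimage_p1Obs_isLeft, mOf_eq_tsum_ite,
      tsum_fintype]
    simp only [Set.mem_ofPred_eq, hμ]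
    rw [Fin.sum_univ_eq_sum_range
      (fun i => if 8 ∣ i then ((2 ^ (8 * k) : ℕ) : ℝ≥0∞)⁻¹ else 0)]
    obtain ⟨n, hn⟩ : 8 ∣ 2 ^ (8 * k) := pow_dvd_pow 2 (show 3 ≤ 8 * k by lia)
    have hn₀ : (n : ℝ≥0∞) ≠ 0 := by
      rintro h
      rw [Nat.cast_eq_zero.1 h] at hn
      simp at hn
    rw [hn, sum_range_ite_eight_dvd, Nat.cast_mul, mul_comm ((8 : ℕ) : ℝ≥0∞),
      ← div_eq_mul_inv]
    simpa using ENNReal.mul_div_mul_left 1 8 hn₀ (ENNReal.natCast_ne_top n)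
  · rw [LPSO, ← preimage_p1Obs_isLeft, ← Set.preimage_compl, LPO_preimage, LPO_preimage,
      Set.preimage_compl, mOf_add_mOf_compl]
end
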